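/- Let q, a, b, t be complex numbers with |q| < 1 such that a·t·q^k ≠ 1 for every integer k ≥ 1. Then Σ_{k=0}^{∞} (bt)^k q^{k(k+1)/2} / ( (q;q)_k (atq;q)_k ) = Σ_{m=0}^{∞} (bt)^m q^{m(m+1)/2} · ( ∏_{i=m+1}^{∞} (1 + b t q^i) ) · (at)^m q^{m²} / ( (q;q)_m (atq;q)_m ), where all series and products converge absolutely under these hypotheses. -/

import Mathlib

open scoped BigOperators

/-- The finite q-Pochhammer symbol `(a;q)_n = ∏_{i=0}^{n-1} (1 - a q^i)`. -/
noncomputable def qPoch (a q : ℂ) (n : ℕ) : ℂ := ∏ i ∈ Finset.range n, (1 - a * q ^ i)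

lemma qPoch_succ (a q : ℂ) (n : ℕ) : qPoch a q (n + 1) = qPoch a q n * (1 - a * q ^ n) :=
  Finset.prod_range_succ _ _

lemma qPoch_succ' (a q : ℂ) (n : ℕ) : qPoch a q (n + 1) = (1 - a) * qPoch (a * q) q n := by
  rw [qPoch, Finset.prod_range_succ', mul_comm, qPoch]
  simp [pow_succ', mul_assoc]

lemma qPoch_mul_self_ne_zero {y q : ℂ} (hy : ∀ k : ℕ, 1 ≤ k → y * q ^ k ≠ 1) (n : ℕ) :
    qPoch (y * q) q n ≠ 0 := by
  refine Finset.prod_ne_zero_iff.2 fun i _ h => hy (i + 1) (by omega) ?_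
  linear_combination -h

lemma qPoch_self_ne_zero {q : ℂ} (hq : ‖q‖ < 1) (n : ℕ) : qPoch q q n ≠ 0 := by
  have := qPoch_mul_self_ne_zero (y := 1) (q := q) (fun k hk h => ?_) n
  · simpa using this
  · have h' := congrArg norm h
    rw [one_mul, norm_pow, norm_one] at h'
    exact (pow_lt_one₀ (norm_nonneg _) hq (by omega)).ne h'

lemma triangle_succ (k : ℕ) : (k + 1) * (k + 1 + 1) / 2 = k * (k + 1) / 2 + (k + 1) := by
  rw [show (k + 1) * (k + 1 + 1) = k * (k + 1) + (k + 1) * 2 by ring,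
    Nat.add_mul_div_right _ _ two_pos]

lemma triangle_add (m j : ℕ) :
    (m + j) * (m + j + 1) / 2 = m * (m + 1) / 2 + j * (j + 1) / 2 + m * j := by
  induction j with
  | zero => simp
  | succ j ih =>
    rw [← add_assoc, triangle_succ, ih, triangle_succ]
    ring

/-- The Gaussian binomial coefficient, defined by the `q`-Pascal recurrence. -/
noncomputable def gaussBinom (q : ℂ) : ℕ → ℕ → ℂ
  | _, 0 => 1
  | 0, _ + 1 => 0
  | n + 1, m + 1 => q ^ (m + 1) * gaussBinom q n (m + 1) + gaussBinom q n m

lemma gaussBinom_zero_right (q : ℂ) (n : ℕ) : gaussBinom q n 0 = 1 := by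
  cases n <;> rfl

lemma gaussBinom_eq_zero (q : ℂ) {n m : ℕ} (h : n < m) : gaussBinom q n m = 0 := by
  induction n generalizing m with
  | zero => obtain ⟨m, rfl⟩ := Nat.exists_eq_succ_of_ne_zero h.ne'; rfl
  | succ n ih =>
    obtain ⟨m, rfl⟩ := Nat.exists_eq_succ_of_ne_zero (Nat.ne_zero_of_lt h)
    rw [gaussBinom, ih (by omega), ih (by omega)]
    simp

lemma gaussBinom_mul_qPoch (q : ℂ) (m j : ℕ) :
    gaussBinom q (m + j) m * (qPoch q q m * qPoch q q j) = qPoch q q (m + j) := by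
  induction m generalizing j with
  | zero => simp [gaussBinom_zero_right, qPoch]
  | succ m ihm =>
    induction j with
    | zero =>
      have h := ihm 0
      rw [add_zero] at h ⊢
      rw [gaussBinom, gaussBinom_eq_zero q (Nat.lt_succ_self m), qPoch_succ]
      linear_combination (1 - q * q ^ m) * h
    | succ j ihj =>
      have h := ihm (j + 1)
      rw [show m + 1 + (j + 1) = (m + j + 1) + 1 by ring, gaussBinom, qPoch_succ q q (m + j + 1)]
      rw [show m + 1 + j = m + j + 1 by ring] at ihj
      rw [show m + (j + 1) = m + j + 1 by ring] at h
      rw [qPoch_succ q q j] at h ⊢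
      rw [qPoch_succ q q m] at ihj ⊢
      linear_combination q ^ (m + 1) * (1 - q * q ^ j) * ihj + (1 - q * q ^ m) * h

/-- Cauchy's finite identity `∑_m [k, m]_q y^m q^{m²} / (yq;q)_m = 1 / (yq;q)_k`. -/
lemma sum_gaussBinom_div_qPoch {y q : ℂ} (hy : ∀ k : ℕ, 1 ≤ k → y * q ^ k ≠ 1) (k : ℕ) :
    ∑ m ∈ Finset.range (k + 1), gaussBinom q k m * (y ^ m * q ^ (m ^ 2)) / qPoch (y * q) q m
      = 1 / qPoch (y * q) q k := by
  induction k generalizing y with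
  | zero => simp [gaussBinom_zero_right, qPoch]
  | succ k ih =>
    have hyq : ∀ k : ℕ, 1 ≤ k → y * q * q ^ k ≠ 1 := fun k hk h =>
      hy (k + 1) (by omega) (by rw [← h]; ring)
    have h1 : 1 - y * q ≠ 0 := fun h => hy 1 le_rfl (by linear_combination -h)
    rw [qPoch_succ', one_div, mul_inv, ← one_div (qPoch _ _ _), ← ih hyq, Finset.mul_sum,
      Finset.sum_range_succ']
    have hsplit : ∀ m ∈ Finset.range (k + 1),
        gaussBinom q (k + 1) (m + 1) * (y ^ (m + 1) * q ^ ((m + 1) ^ 2)) / qPoch (y * q) q (m + 1)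
        = q ^ (m + 1) * gaussBinom q k (m + 1) * (y ^ (m + 1) * q ^ ((m + 1) ^ 2)) /
            qPoch (y * q) q (m + 1)
          + gaussBinom q k m * (y ^ (m + 1) * q ^ ((m + 1) ^ 2)) / qPoch (y * q) q (m + 1) := by
      intro m _
      rw [gaussBinom]; ring
    have hshift := Finset.sum_range_succ' (fun m => q ^ m * gaussBinom q k m *
      (y ^ m * q ^ (m ^ 2)) / qPoch (y * q) q m) (k + 1)
    rw [Finset.sum_range_succ, gaussBinom_eq_zero q (Nat.lt_succ_self k)] at hshift
    rw [Finset.sum_congr rfl hsplit, Finset.sum_add_distrib]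
    have hcomb : ∀ m ∈ Finset.range (k + 1),
        q ^ m * gaussBinom q k m * (y ^ m * q ^ (m ^ 2)) / qPoch (y * q) q m
          + gaussBinom q k m * (y ^ (m + 1) * q ^ ((m + 1) ^ 2)) / qPoch (y * q) q (m + 1)
        = (1 - y * q)⁻¹ *
          (gaussBinom q k m * ((y * q) ^ m * q ^ (m ^ 2)) / qPoch (y * q * q) q m) := by
      intro m _
      have hm := qPoch_mul_self_ne_zero hy m
      have hm' := qPoch_mul_self_ne_zero hyq m
      have hf : 1 - y * q * q ^ m ≠ 0 := fun h =>
        hy (m + 1) (by omega) (by linear_combination -h)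
      have e := (qPoch_succ (y * q) q m).symm.trans (qPoch_succ' (y * q) q m)
      rw [show (1 - y * q)⁻¹ * (gaussBinom q k m * ((y * q) ^ m * q ^ (m ^ 2)) /
          qPoch (y * q * q) q m) = gaussBinom q k m * ((y * q) ^ m * q ^ (m ^ 2)) /
          (qPoch (y * q) q m * (1 - y * q * q ^ m)) by rw [e]; field_simp, qPoch_succ]
      generalize hd : 1 - y * q * q ^ m = d at hf ⊢
      field_simp
      rw [← hd]
      ring
    rw [← Finset.sum_congr rfl hcomb, Finset.sum_add_distrib]
    simp only [gaussBinom_zero_right, pow_zero, one_mul] at hshift ⊢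
    linear_combination -hshift

lemma sum_antidiagonal_div_qPoch {y q : ℂ} (hq : ‖q‖ < 1)
    (hy : ∀ k : ℕ, 1 ≤ k → y * q ^ k ≠ 1) (k : ℕ) :
    ∑ p ∈ Finset.HasAntidiagonal.antidiagonal k,
        y ^ p.1 * q ^ (p.1 ^ 2) / (qPoch q q p.1 * qPoch (y * q) q p.1 * qPoch q q p.2)
      = 1 / (qPoch q q k * qPoch (y * q) q k) := by
  rw [one_div, mul_inv, ← one_div (qPoch (y * q) q k), ← sum_gaussBinom_div_qPoch hy,
    Finset.mul_sum, Finset.Nat.sum_antidiagonal_eq_sum_range_succ_mk]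
  refine Finset.sum_congr rfl fun m hm => ?_
  obtain ⟨j, rfl⟩ := Nat.exists_eq_add_of_le (Nat.lt_succ_iff.1 (Finset.mem_range.1 hm))
  have h := gaussBinom_mul_qPoch q m j
  have h1 := qPoch_self_ne_zero hq m
  have h2 := qPoch_self_ne_zero hq j
  have h3 := qPoch_self_ne_zero hq (m + j)
  have h4 := qPoch_mul_self_ne_zero hy m
  simp only [Nat.add_sub_cancel_left]
  rw [← h] at h3 ⊢
  have h5 := left_ne_zero_of_mul h3
  field_simp

lemma summable_norm_of_succ_eq_mul {f c : ℕ → ℂ} (h : ∀ n, f (n + 1) = c n * f n)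
    (hc : Filter.Tendsto c Filter.atTop (nhds 0)) : Summable fun n => ‖f n‖ := by
  refine summable_of_ratio_norm_eventually_le (r := 1 / 2) (by norm_num) ?_
  have h0 := hc.norm
  rw [norm_zero] at h0
  filter_upwards [h0.eventually_le_const (show (0 : ℝ) < 1 / 2 by norm_num)] with n hn
  rw [h, norm_norm, norm_norm, norm_mul]
  gcongr

lemma tendsto_mul_pow_div {q : ℂ} (hq : ‖q‖ < 1) (x y : ℂ) :
    Filter.Tendsto (fun n : ℕ => x * q ^ (n + 1) / ((1 - q * q ^ n) * (1 - y * q * q ^ n)))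
      Filter.atTop (nhds 0) := by
  have h := tendsto_pow_atTop_nhds_zero_of_norm_lt_one hq
  have h' := h.comp (Filter.tendsto_add_atTop_nat 1)
  have := (h'.const_mul x).div (((h.const_mul q).const_sub 1).mul ((h.const_mul (y * q)).const_sub 1))
    (by simp)
  simpa [Pi.div_def] using this

lemma summable_norm_qPoch_series {q : ℂ} (hq : ‖q‖ < 1) (x y : ℂ) :
    Summable fun k : ℕ =>
      ‖x ^ k * q ^ (k * (k + 1) / 2) / (qPoch q q k * qPoch (y * q) q k)‖ := by
  refine summable_norm_of_succ_eq_mul (fun n => ?_) (tendsto_mul_pow_div hq x y)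
  rw [triangle_succ, qPoch_succ, qPoch_succ]
  simp only [div_eq_mul_inv, mul_inv]
  ring

lemma summable_norm_euler_series {q : ℂ} (hq : ‖q‖ < 1) (x : ℂ) :
    Summable fun k : ℕ => ‖x ^ k * q ^ (k * (k + 1) / 2) / qPoch q q k‖ := by
  simpa [qPoch] using summable_norm_qPoch_series hq x 0

lemma summable_norm_mul_pow_add {q : ℂ} (hq : ‖q‖ < 1) (x : ℂ) {n : ℕ} :
    Summable fun i : ℕ => ‖x * q ^ (n + i)‖ := by
  simp only [norm_mul, norm_pow, pow_add]
  exact ((summable_geometric_of_lt_one (norm_nonneg _) hq).mul_left _).mul_left _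

/-- Euler's expansion of `(-xq;q)_∞`. -/
lemma tprod_one_add_eq_tsum {q : ℂ} (hq : ‖q‖ < 1) (x : ℂ) :
    ∏' i : ℕ, (1 + x * q ^ (1 + i)) = ∑' k : ℕ, x ^ k * q ^ (k * (k + 1) / 2) / qPoch q q k := by
  set F : ℂ → ℂ := fun z => ∑' k : ℕ, z ^ k * q ^ (k * (k + 1) / 2) / qPoch q q k with hF
  have hs : ∀ z : ℂ, Summable fun k : ℕ => z ^ k * q ^ (k * (k + 1) / 2) / qPoch q q k :=
    fun z => (summable_norm_euler_series hq z).of_norm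
  have hfun : ∀ z, F z = (1 + z * q) * F (z * q) := by
    intro z
    have e1 := (hs z).tsum_eq_zero_add
    have e2 := (hs (z * q)).tsum_eq_zero_add
    have e3 : ∑' k : ℕ, z ^ (k + 1) * q ^ ((k + 1) * (k + 1 + 1) / 2) / qPoch q q (k + 1)
        = ∑' k : ℕ, (z * q) ^ (k + 1) * q ^ ((k + 1) * (k + 1 + 1) / 2) / qPoch q q (k + 1)
          + z * q * F (z * q) := by
      rw [hF, ← tsum_mul_left, ← ((summable_nat_add_iff 1).2 (hs (z * q))).tsum_add
        ((hs (z * q)).mul_left _)]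
      refine tsum_congr fun k => ?_
      have h1 := qPoch_self_ne_zero hq k
      have h2 := qPoch_self_ne_zero hq (k + 1)
      rw [qPoch_succ] at h2 ⊢
      have h3 := right_ne_zero_of_mul h2
      rw [triangle_succ]
      field_simp
      ring
    simp only [hF] at e3 ⊢
    rw [e1, e3, add_mul, one_mul]
    nth_rewrite 2 [e2]
    simp only [pow_zero]
    ring
  have hiter : ∀ n : ℕ, F x = (∏ i ∈ Finset.range n, (1 + x * q ^ (1 + i))) * F (x * q ^ n) := by
    intro n
    induction n with
    | zero => simp
    | succ n ih =>
      rw [ih, hfun (x * q ^ n), Finset.prod_range_succ, pow_succ, pow_add]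
      ring_nf
  have hlim : Filter.Tendsto (fun n : ℕ => F (x * q ^ n)) Filter.atTop (nhds (F 0)) := by
    refine tendsto_tsum_of_dominated_convergence (summable_norm_euler_series hq x)
      (fun k => ?_) (Filter.Eventually.of_forall fun n k => ?_)
    · have h := (tendsto_pow_atTop_nhds_zero_of_norm_lt_one hq).const_mul x
      rw [mul_zero] at h
      exact ((h.pow k).mul_const _).div_const _
    · simp only [norm_div, norm_mul, norm_pow]
      gcongr
      exact mul_le_of_le_one_right (norm_nonneg _) (pow_le_one₀ (norm_nonneg _) hq.le)
  have hF0 : F 0 = 1 := by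
    simp only [hF]
    rw [tsum_eq_single 0 (fun k hk => by simp [hk])]
    simp [qPoch]
  have hprod := (multipliable_one_add_of_summable
    (summable_norm_mul_pow_add hq x (n := 1))).hasProd.tendsto_prod_nat
  have h := hprod.mul hlim
  rw [hF0, mul_one] at h
  exact tendsto_nhds_unique h (tendsto_const_nhds.congr hiter)

lemma tprod_one_add_shift_eq_tsum {q : ℂ} (hq : ‖q‖ < 1) (x : ℂ) (m : ℕ) :
    ∏' i : ℕ, (1 + x * q ^ (m + 1 + i))
      = ∑' k : ℕ, (x * q ^ m) ^ k * q ^ (k * (k + 1) / 2) / qPoch q q k := by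
  rw [← tprod_one_add_eq_tsum hq]
  exact tprod_congr fun i => by ring

lemma summable_norm_square_series {q : ℂ} (hq : ‖q‖ < 1) (x y : ℂ) :
    Summable fun m : ℕ => ‖x ^ m * q ^ (m * (m + 1) / 2) * (y ^ m * q ^ (m ^ 2)) /
      (qPoch q q m * qPoch (y * q) q m)‖ := by
  have hc := (tendsto_mul_pow_div hq x y).mul
    (((tendsto_pow_atTop_nhds_zero_of_norm_lt_one hq).pow 2).const_mul (y * q))
  simp only [ne_eq, OfNat.ofNat_ne_zero, not_false_eq_true, zero_pow, mul_zero] at hc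
  refine summable_norm_of_succ_eq_mul (fun n => ?_) hc
  rw [triangle_succ, qPoch_succ, qPoch_succ]
  simp only [div_eq_mul_inv, mul_inv]
  ring

/-- The identity of `stmt1` in the variables `x = bt`, `y = at`, together with the summability
of the right-hand side. -/
lemma summable_and_tsum_eq {x y q : ℂ} (hq : ‖q‖ < 1)
    (hy : ∀ k : ℕ, 1 ≤ k → y * q ^ k ≠ 1) :
    Summable (fun m : ℕ =>
      ‖x ^ m * q ^ (m * (m + 1) / 2) * (∏' i : ℕ, (1 + x * q ^ (m + 1 + i))) *
        (y ^ m * q ^ (m ^ 2)) / (qPoch q q m * qPoch (y * q) q m)‖) ∧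
    ∑' k : ℕ, x ^ k * q ^ (k * (k + 1) / 2) / (qPoch q q k * qPoch (y * q) q k)
      = ∑' m : ℕ, x ^ m * q ^ (m * (m + 1) / 2) *
          (∏' i : ℕ, (1 + x * q ^ (m + 1 + i))) *
          (y ^ m * q ^ (m ^ 2)) / (qPoch q q m * qPoch (y * q) q m) := by
  set A : ℕ → ℂ := fun m => x ^ m * q ^ (m * (m + 1) / 2) * (y ^ m * q ^ (m ^ 2)) /
      (qPoch q q m * qPoch (y * q) q m) with hA
  set f : ℕ × ℕ → ℂ := fun p =>
    A p.1 * ((x * q ^ p.1) ^ p.2 * q ^ (p.2 * (p.2 + 1) / 2) / qPoch q q p.2) with hf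
  have hfs : Summable fun p => ‖f p‖ := by
    refine Summable.of_nonneg_of_le (fun _ => norm_nonneg _) (fun p => ?_)
      ((summable_norm_square_series hq x y).mul_of_nonneg (summable_norm_euler_series hq x)
        (fun _ => norm_nonneg _) (fun _ => norm_nonneg _))
    rw [hf, norm_mul]
    refine mul_le_mul_of_nonneg_left ?_ (norm_nonneg _)
    simp only [norm_div, norm_mul, norm_pow]
    gcongr
    exact mul_le_of_le_one_right (norm_nonneg _) (pow_le_one₀ (norm_nonneg _) hq.le)
  have hrow : ∀ m : ℕ, x ^ m * q ^ (m * (m + 1) / 2) * (∏' i : ℕ, (1 + x * q ^ (m + 1 + i))) *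
      (y ^ m * q ^ (m ^ 2)) / (qPoch q q m * qPoch (y * q) q m) = ∑' j : ℕ, f (m, j) := by
    intro m
    rw [tprod_one_add_shift_eq_tsum hq]
    simp only [hf, hA]
    rw [tsum_mul_left]
    ring
  have hdiag : ∀ k : ℕ, x ^ k * q ^ (k * (k + 1) / 2) / (qPoch q q k * qPoch (y * q) q k)
      = ∑ p ∈ Finset.HasAntidiagonal.antidiagonal k, f p := by
    intro k
    rw [div_eq_mul_one_div, ← sum_antidiagonal_div_qPoch hq hy, Finset.mul_sum]
    refine Finset.sum_congr rfl fun p hp => ?_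
    rw [← Finset.HasAntidiagonal.mem_antidiagonal.1 hp, triangle_add]
    simp only [hf, hA, div_eq_mul_inv, mul_inv]
    ring
  simp only [hrow, hdiag]
  refine ⟨Summable.of_nonneg_of_le (fun _ => norm_nonneg _)
    (fun m => norm_tsum_le_tsum_norm (hfs.prod_factor m)) hfs.prod, ?_⟩
  rw [← hfs.of_norm.tsum_prod, ← Finset.HasAntidiagonal.sigmaAntidiagonalEquivProd.tsum_eq f]
  refine Eq.trans (tsum_congr fun k => ?_) (Summable.tsum_sigma
    (Finset.HasAntidiagonal.sigmaAntidiagonalEquivProd.summable_iff.2 hfs.of_norm)).symm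
  rw [tsum_fintype, ← Finset.sum_coe_sort]
  rfl

/-- Equivalent form of Ismail's identity: for `|q| < 1` with `atq^k ≠ 1` for all `k ≥ 1`,
`Σ_k (bt)^k q^{k(k+1)/2} / ((q;q)_k (atq;q)_k)
 = Σ_m (bt)^m q^{m(m+1)/2} (−btq^{m+1};q)_∞ (at)^m q^{m²} / ((q;q)_m (atq;q)_m)`,
with all series and products converging absolutely. -/
theorem stmt1 (q a b t : ℂ) (hq : ‖q‖ < 1)
    (ha : ∀ k : ℕ, 1 ≤ k → a * t * q ^ k ≠ 1) :
    Summable (fun k : ℕ =>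
      ‖(b * t) ^ k * q ^ (k * (k + 1) / 2) / (qPoch q q k * qPoch (a * t * q) q k)‖) ∧
    (∀ m : ℕ, Multipliable (fun i : ℕ => 1 + b * t * q ^ (m + 1 + i))) ∧
    Summable (fun m : ℕ =>
      ‖(b * t) ^ m * q ^ (m * (m + 1) / 2) * (∏' i : ℕ, (1 + b * t * q ^ (m + 1 + i))) *
        ((a * t) ^ m * q ^ (m ^ 2)) / (qPoch q q m * qPoch (a * t * q) q m)‖) ∧
    ∑' k : ℕ, (b * t) ^ k * q ^ (k * (k + 1) / 2) / (qPoch q q k * qPoch (a * t * q) q k)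
      = ∑' m : ℕ, (b * t) ^ m * q ^ (m * (m + 1) / 2) *
          (∏' i : ℕ, (1 + b * t * q ^ (m + 1 + i))) *
          ((a * t) ^ m * q ^ (m ^ 2)) / (qPoch q q m * qPoch (a * t * q) q m) := by
  refine ⟨summable_norm_qPoch_series hq _ _, fun m => ?_, summable_and_tsum_eq hq ha⟩
  exact multipliable_one_add_of_summable (summable_norm_mul_pow_add hq _)
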